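/- Let ν < 0 be such that α := |1 + ν/2| is not an integer. Then there exists a constant C_ν > 0 such that for every nonzero integer k, every real r ≥ 1, and every n ∈ {0,1,2}, the function 𝒦_k(r) := r^{ν/2} K_α(|k| r) satisfies | (d^n/dr^n) 𝒦_k(r) | ≤ C_ν |k|^{n − 1/2} r^{(ν−1)/2} e^{−|k| r}. -/

import Mathlib

open MeasureTheory Filter Set

/-- Modified Bessel function of the first kind `I_α`. -/
noncomputable def besselI (α x : ℝ) : ℝ :=
  ∑' m : ℕ, (1 / ((m.factorial : ℝ) * Real.Gamma ((m : ℝ) + α + 1)))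
    * (x / 2) ^ (2 * (m : ℝ) + α)

/-- Modified Bessel function of the second kind `K_α` (non-integer `α`). -/
noncomputable def besselK (α x : ℝ) : ℝ :=
  (Real.pi / 2) * (besselI (-α) x - besselI α x) / Real.sin (α * Real.pi)

/-- The coefficients of the entire function `z ↦ (√z)^(-β) * I_β(2√z)`. -/
noncomputable def besselCoeff (β : ℝ) (m : ℕ) : ℝ :=
  1 / ((m.factorial : ℝ) * Real.Gamma ((m : ℝ) + β + 1))

/-- The entire function `z ↦ (√z)^(-β) * I_β(2√z)`. -/
noncomputable def besselEntire (β z : ℝ) : ℝ :=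
  ∑' m : ℕ, besselCoeff β m * z ^ m

theorem besselCoeff_succ_mul (β : ℝ) (m : ℕ) :
    besselCoeff β (m + 1) * (m + 1) = besselCoeff (β + 1) m := by
  unfold besselCoeff
  have h : ((m + 1 : ℕ) : ℝ) + β + 1 = (m : ℝ) + (β + 1) + 1 := by push_cast; ring
  have h' : (m : ℝ) + 1 ≠ 0 := by positivity
  rw [h, Nat.factorial_succ, Nat.cast_mul, Nat.cast_succ, one_div, one_div, mul_inv, mul_inv,
    mul_inv]
  field_simp

theorem besselCoeff_sub_one (β : ℝ) (m : ℕ) :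
    besselCoeff (β - 1) m = (m + β) * besselCoeff β m := by
  unfold besselCoeff
  rw [show (m : ℝ) + (β - 1) + 1 = m + β by ring]
  by_cases h : (m : ℝ) + β = 0
  · simp [h, Real.Gamma_zero]
  · rw [Real.Gamma_add_one h, one_div, one_div, mul_inv, mul_inv, mul_inv]
    field_simp

theorem summable_besselCoeff_mul_pow (β R : ℝ) :
    Summable fun m => besselCoeff β m * R ^ m := by
  refine summable_of_isBigO_nat (Real.summable_pow_div_factorial R) ?_
  refine Asymptotics.IsBigO.of_bound 1 ?_
  filter_upwards [eventually_ge_atTop ⌈1 - β⌉₊] with m hm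
  have h2 : 2 ≤ (m : ℝ) + β + 1 := by linarith [Nat.ceil_le.1 hm]
  have hG : 1 ≤ Real.Gamma ((m : ℝ) + β + 1) := by
    simpa only [Real.Gamma_two] using
      Real.Gamma_strictMonoOn_Ici.monotoneOn (mem_Ici.2 le_rfl) (mem_Ici.2 h2) h2
  have : besselCoeff β m * R ^ m =
      R ^ m / m.factorial * (Real.Gamma ((m : ℝ) + β + 1))⁻¹ := by
    rw [besselCoeff, one_div, mul_inv]
    ring
  rw [this, norm_mul, mul_comm]
  gcongr
  rw [norm_inv]
  exact inv_le_one_of_one_le₀ (hG.trans (le_abs_self _))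

theorem hasDerivAt_besselEntire (β z : ℝ) :
    HasDerivAt (besselEntire β) (besselEntire (β + 1) z) z := by
  set R := |z| + 1 with hR
  have hR0 : 0 < R := by positivity
  have hcoef : ∀ m : ℕ, besselCoeff β m * (m * z ^ (m - 1)) =
      Nat.casesOn m 0 fun j => besselCoeff (β + 1) j * z ^ j := by
    rintro (_ | m)
    · simp
    · simp only [Nat.add_sub_cancel, ← besselCoeff_succ_mul]
      push_cast
      ring
  have hsum (w : ℝ) : Summable fun m : ℕ => besselCoeff β m * (m * w ^ (m - 1)) := by
    refine (summable_nat_add_iff 1).1 ?_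
    refine (summable_besselCoeff_mul_pow (β + 1) w).congr fun m => ?_
    simp only [Nat.add_sub_cancel, ← besselCoeff_succ_mul]
    push_cast
    ring
  have key := hasDerivAt_tsum_of_isPreconnected (hsum R).norm (t := Metric.ball (0 : ℝ) R)
    (g := fun m w => besselCoeff β m * w ^ m)
    (g' := fun (m : ℕ) w => besselCoeff β m * (m * w ^ (m - 1)))
    Metric.isOpen_ball (convex_ball _ _).isPreconnected
    (fun m w _ => (hasDerivAt_pow m w).const_mul _)
    (fun m w hw => by
      have hw' : |w| ≤ R := (mem_ball_zero_iff.1 hw).le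
      simp only [norm_mul, norm_pow, Real.norm_eq_abs, abs_of_pos hR0]
      gcongr)
    (y₀ := 0) (Metric.mem_ball_self hR0) (summable_besselCoeff_mul_pow β 0)
    (y := z) (by simp [hR])
  convert! key using 1
  rw [(hsum z).tsum_eq_zero_add]
  simp only [Nat.cast_zero, zero_mul, mul_zero, zero_add, Nat.add_sub_cancel, besselEntire]
  refine tsum_congr fun m => ?_
  rw [← besselCoeff_succ_mul]
  push_cast
  ring

theorem besselEntire_sub_one (β z : ℝ) :
    besselEntire (β - 1) z = β * besselEntire β z + z * besselEntire (β + 1) z := by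
  have h1 := summable_besselCoeff_mul_pow β z
  have h2 : Summable fun m : ℕ => m * (besselCoeff β m * z ^ m) := by
    refine (summable_nat_add_iff 1).1 ?_
    refine ((summable_besselCoeff_mul_pow (β + 1) z).mul_left z).congr fun m => ?_
    rw [← besselCoeff_succ_mul]
    push_cast
    ring
  have h3 : ∑' m : ℕ, m * (besselCoeff β m * z ^ m) = z * besselEntire (β + 1) z := by
    rw [h2.tsum_eq_zero_add, besselEntire, ← tsum_mul_left]
    simp only [Nat.cast_zero, zero_mul, zero_add]
    refine tsum_congr fun m => ?_
    rw [← besselCoeff_succ_mul]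
    push_cast
    ring
  rw [← h3, besselEntire, besselEntire, ← tsum_mul_left, ← (h1.mul_left β).tsum_add h2]
  refine tsum_congr fun m => ?_
  rw [besselCoeff_sub_one]
  ring

theorem besselI_eq (β : ℝ) {x : ℝ} (hx : 0 < x) :
    besselI β x = (x / 2) ^ β * besselEntire β (x ^ 2 / 4) := by
  rw [besselI, besselEntire, ← tsum_mul_left]
  refine tsum_congr fun m => ?_
  have h : (2 * (m : ℝ)) = ((2 * m : ℕ) : ℝ) := by push_cast; ring
  rw [h, Real.rpow_add (by positivity), Real.rpow_natCast, pow_mul,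
    show (x / 2) ^ 2 = x ^ 2 / 4 by ring, besselCoeff]
  ring

theorem besselI_sub_one (β : ℝ) {x : ℝ} (hx : 0 < x) :
    besselI (β - 1) x = besselI (β + 1) x + 2 * β / x * besselI β x := by
  have h2 : 0 < x / 2 := by positivity
  rw [besselI_eq _ hx, besselI_eq _ hx, besselI_eq _ hx, besselEntire_sub_one,
    Real.rpow_sub_one h2.ne', Real.rpow_add_one h2.ne']
  field_simp
  ring

theorem hasDerivAt_besselI (β : ℝ) {x : ℝ} (hx : 0 < x) :
    HasDerivAt (besselI β) (besselI (β + 1) x + β / x * besselI β x) x := by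
  have h2 : 0 < x / 2 := by positivity
  have h1 : HasDerivAt (fun y : ℝ => (y / 2) ^ β) (1 / 2 * β * (x / 2) ^ (β - 1)) x :=
    ((hasDerivAt_id x).div_const 2).rpow_const (Or.inl h2.ne')
  have h3 : HasDerivAt (fun y : ℝ => besselEntire β (y ^ 2 / 4))
      (besselEntire (β + 1) (x ^ 2 / 4) * (2 * x / 4)) x := by
    have := (hasDerivAt_besselEntire β (x ^ 2 / 4)).comp x
      (h := fun y => y ^ 2 / 4) ((hasDerivAt_pow 2 x).div_const 4)
    simpa [Function.comp_def] using this
  have h4 := (h1.mul h3).congr_of_eventuallyEq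
    (f₁ := besselI β) (by
      filter_upwards [lt_mem_nhds hx] with y hy
      exact besselI_eq β hy)
  convert! h4 using 1
  rw [besselI_eq _ hx, besselI_eq _ hx, Real.rpow_sub_one h2.ne', Real.rpow_add_one h2.ne']
  field_simp
  ring

theorem hasDerivAt_besselI' (β : ℝ) {x : ℝ} (hx : 0 < x) :
    HasDerivAt (besselI β) (besselI (β - 1) x - β / x * besselI β x) x := by
  convert! hasDerivAt_besselI β hx using 1
  rw [besselI_sub_one β hx]
  ring

theorem besselI_pos {β : ℝ} (hβ : 0 < β) {x : ℝ} (hx : 0 < x) : 0 < besselI β x := by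
  rw [besselI_eq _ hx]
  refine mul_pos (by positivity) ?_
  have hc (m : ℕ) : 0 < besselCoeff β m := by
    have := Real.Gamma_pos_of_pos (s := (m : ℝ) + β + 1) (by positivity)
    rw [besselCoeff]; positivity
  exact (summable_besselCoeff_mul_pow β _).tsum_pos
    (fun m => mul_nonneg (hc m).le (by positivity)) 0 (mul_pos (hc 0) (by positivity))

theorem integral_rpow_mul_one_sub_rpow {a b : ℝ} (ha : 0 < a) (hb : 0 < b) :
    ∫ t in (0 : ℝ)..1, t ^ (a - 1) * (1 - t) ^ (b - 1) =
      Real.Gamma a * Real.Gamma b / Real.Gamma (a + b) := by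
  have h := Complex.betaIntegral_eq_Gamma_mul_div a b (by simpa) (by simpa)
  rw [Complex.betaIntegral] at h
  have h' : ∫ t in (0 : ℝ)..1, (t : ℂ) ^ ((a : ℂ) - 1) * (1 - (t : ℂ)) ^ ((b : ℂ) - 1) =
      ∫ t in (0 : ℝ)..1, ((t ^ (a - 1) * (1 - t) ^ (b - 1) : ℝ) : ℂ) := by
    refine intervalIntegral.integral_congr fun t ht => ?_
    rw [uIcc_of_le zero_le_one] at ht
    have h1 : 0 ≤ 1 - t := sub_nonneg.2 ht.2
    push_cast
    rw [Complex.ofReal_cpow ht.1, Complex.ofReal_cpow h1]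
    push_cast
    rfl
  rw [h', intervalIntegral.integral_ofReal, ← Complex.ofReal_add, Complex.Gamma_ofReal,
    Complex.Gamma_ofReal, Complex.Gamma_ofReal] at h
  exact_mod_cast h

theorem integral_pow_mul_one_sub_sq_rpow {γ : ℝ} (hγ : 0 ≤ γ) (m : ℕ) :
    2 * ∫ s in (0 : ℝ)..1, s ^ (2 * m) * (1 - s ^ 2) ^ γ =
      Real.Gamma (m + 1 / 2) * Real.Gamma (γ + 1) / Real.Gamma (m + γ + 3 / 2) := by
  have h := integral_rpow_mul_one_sub_rpow (a := m + 1 / 2) (b := γ + 1) (by positivity)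
    (by positivity)
  rw [show (m : ℝ) + 1 / 2 + (γ + 1) = m + γ + 3 / 2 by ring] at h
  rw [← h, intervalIntegral.integral_of_le zero_le_one,
    intervalIntegral.integral_of_le zero_le_one, ← integral_const_mul]
  have hI : Ioc (0 : ℝ) 1 = Ioi 0 ∩ Ioc 0 1 := by ext; simp +contextual
  rw [hI, ← setIntegral_indicator measurableSet_Ioc, ← setIntegral_indicator measurableSet_Ioc]
  symm
  rw [← integral_comp_rpow_Ioi_of_pos (p := 2) two_pos]
  refine setIntegral_congr_fun measurableSet_Ioi fun s hs => ?_
  have hs0 : 0 < s := hs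
  have hiff : s ^ (2 : ℝ) ∈ Ioc (0 : ℝ) 1 ↔ s ∈ Ioc (0 : ℝ) 1 := by
    simp only [Real.rpow_two, mem_Ioc, hs0, sq_le_one_iff₀ hs0.le, pow_pos hs0, true_and]
  simp only [indicator, hiff]
  split_ifs with h1
  · have e : s * (s ^ 2) ^ ((m : ℝ) + 1 / 2 - 1) = s ^ (2 * m) := by
      nth_rw 1 [← Real.rpow_one s]
      rw [← Real.rpow_natCast, ← Real.rpow_natCast, ← Real.rpow_mul hs0.le, ← Real.rpow_add hs0]
      congr 1
      push_cast
      ring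
    rw [← e]
    norm_num
    ring
  · simp

theorem Real.Gamma_nat_add_half_mul (m : ℕ) :
    Real.Gamma (m + 1 / 2) * (4 ^ m * m.factorial) = √Real.pi * (2 * m).factorial := by
  induction m with
  | zero => simp [-one_div, Real.Gamma_one_half_eq]
  | succ m ih =>
    have h : ((m + 1 : ℕ) : ℝ) + 1 / 2 = ((m : ℝ) + 1 / 2) + 1 := by push_cast; ring
    rw [h, Real.Gamma_add_one (by positivity), show 2 * (m + 1) = 2 * m + 1 + 1 by ring,
      Nat.factorial_succ, Nat.factorial_succ, Nat.factorial_succ]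
    push_cast
    linear_combination (2 * (m : ℝ) + 2) * (2 * m + 1) * ih

theorem besselI_poisson {γ : ℝ} (hγ : 0 ≤ γ) {x : ℝ} (hx : 0 < x) :
    √Real.pi * Real.Gamma (γ + 1) * besselI (γ + 1 / 2) x =
      (x / 2) ^ (γ + 1 / 2) * ∫ s in (0 : ℝ)..1, 2 * Real.cosh (x * s) * (1 - s ^ 2) ^ γ := by
  have hle {s : ℝ} (hs : s ∈ uIoc (0 : ℝ) 1) : 0 ≤ 1 - s ^ 2 ∧ 1 - s ^ 2 ≤ 1 ∧ 0 ≤ s ∧ s ≤ 1 := by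
    rw [uIoc_of_le zero_le_one] at hs
    have := hs.1
    have := hs.2
    refine ⟨?_, ?_, ?_, ?_⟩ <;> nlinarith
  have hsum := intervalIntegral.hasSum_integral_of_dominated_convergence (μ := volume)
    (a := (0 : ℝ)) (b := 1)
    (F := fun (m : ℕ) s => 2 * ((x * s) ^ (2 * m) / (2 * m).factorial) * (1 - s ^ 2) ^ γ)
    (f := fun s => 2 * Real.cosh (x * s) * (1 - s ^ 2) ^ γ)
    (fun m _ => 2 * (x ^ (2 * m) / (2 * m).factorial))
    (fun m => by
      refine Continuous.aestronglyMeasurable ?_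
      refine Continuous.mul (by fun_prop) ?_
      exact Continuous.rpow_const (by fun_prop) fun _ => Or.inr hγ)
    (fun m => Eventually.of_forall fun s hs => by
      obtain ⟨h1, h2, h3, h4⟩ := hle hs
      rw [Real.norm_of_nonneg (by positivity)]
      have h5 : (1 - s ^ 2) ^ γ ≤ 1 := Real.rpow_le_one h1 h2 hγ
      have h6 : x * s ≤ x := mul_le_of_le_one_right hx.le h4
      calc _ ≤ 2 * (x ^ (2 * m) / (2 * m).factorial) * 1 := by gcongr
        _ = _ := mul_one _)
    (Eventually.of_forall fun s _ => (Real.hasSum_cosh x).summable.mul_left 2)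
    (by simp)
    (Eventually.of_forall fun s _ => ((Real.hasSum_cosh (x * s)).mul_left 2).mul_right _)
  rw [← hsum.tsum_eq, besselI_eq _ hx, besselEntire, mul_left_comm, ← tsum_mul_left]
  congr 1
  refine tsum_congr fun m => ?_
  have hm : ∫ s in (0 : ℝ)..1, 2 * ((x * s) ^ (2 * m) / (2 * m).factorial) * (1 - s ^ 2) ^ γ =
      x ^ (2 * m) / (2 * m).factorial * (2 * ∫ s in (0 : ℝ)..1, s ^ (2 * m) * (1 - s ^ 2) ^ γ) := by
    rw [← intervalIntegral.integral_const_mul, ← intervalIntegral.integral_const_mul]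
    congr 1
    ext s
    rw [mul_pow]
    ring
  have hfac := Real.Gamma_nat_add_half_mul m
  rw [hm, integral_pow_mul_one_sub_sq_rpow hγ, besselCoeff,
    show (m : ℝ) + (γ + 1 / 2) + 1 = m + γ + 3 / 2 by ring, div_pow, ← pow_mul]
  have hG : Real.Gamma (m + γ + 3 / 2) ≠ 0 := (Real.Gamma_pos_of_pos (by positivity)).ne'
  generalize Real.Gamma (m + 1 / 2) = g at hfac ⊢
  field_simp
  linear_combination -hfac

theorem tendsto_integral_cosh_mul_one_sub_sq_rpow {γ : ℝ} (hγ : 0 ≤ γ) :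
    Tendsto (fun x => x ^ (γ + 1) * Real.exp (-x) *
      ∫ s in (0 : ℝ)..1, 2 * Real.cosh (x * s) * (1 - s ^ 2) ^ γ) atTop
      (nhds (2 ^ γ * Real.Gamma (γ + 1))) := by
  set g : ℝ → ℝ → ℝ := fun x u =>
    (Real.exp (-u) + Real.exp (u - 2 * x)) * (u * (2 - u / x)) ^ γ with hg
  have hsubst : ∀ᶠ x in atTop, ∫ u in Ioi (0 : ℝ), (Ioc 0 x).indicator (g x) u =
      x ^ (γ + 1) * Real.exp (-x) *
        ∫ s in (0 : ℝ)..1, 2 * Real.cosh (x * s) * (1 - s ^ 2) ^ γ := by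
    filter_upwards [eventually_gt_atTop 0] with x hx
    have h := intervalIntegral.integral_comp_sub_div (a := 0) (b := x)
      (fun s => 2 * Real.cosh (x * s) * (1 - s ^ 2) ^ γ) hx.ne' 1
    rw [div_self hx.ne', zero_div, sub_self, sub_zero, smul_eq_mul] at h
    have hI : Ioc (0 : ℝ) x = Ioi 0 ∩ Ioc 0 x := by ext; simp +contextual
    rw [setIntegral_indicator measurableSet_Ioc, ← hI, Real.rpow_add_one hx.ne',
      show ∀ F : ℝ, x ^ γ * x * Real.exp (-x) * F = x ^ γ * Real.exp (-x) * (x * F) by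
        intro F; ring, ← h, ← intervalIntegral.integral_const_mul,
      intervalIntegral.integral_of_le hx.le]
    refine setIntegral_congr_fun measurableSet_Ioc fun u hu => ?_
    have h1 : 1 - (1 - u / x) ^ 2 = u * (2 - u / x) / x := by field_simp; ring
    have h2 : 0 ≤ 2 - u / x := by
      have := (div_le_one hx).2 hu.2
      linarith
    have h3 : x * (1 - u / x) = x - u := by field_simp
    simp only [hg]
    rw [h1, h3, Real.div_rpow (mul_nonneg hu.1.le h2) hx.le, Real.cosh_eq]
    have h4 : Real.exp (-u) = Real.exp (-x) * Real.exp (x - u) := by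
      rw [← Real.exp_add]; ring_nf
    have h5 : Real.exp (u - 2 * x) = Real.exp (-x) * Real.exp (-(x - u)) := by
      rw [← Real.exp_add]; ring_nf
    rw [h4, h5]
    have := (Real.rpow_pos_of_pos hx γ).ne'
    field_simp
  refine Tendsto.congr' hsubst ?_
  rw [Real.Gamma_eq_integral (by positivity), ← integral_const_mul]
  refine tendsto_integral_filter_of_dominated_convergence
    (fun u => 2 * 2 ^ γ * (Real.exp (-u) * u ^ (γ + 1 - 1))) ?_ ?_ ?_ ?_
  · refine Eventually.of_forall fun x => ?_
    refine (Measurable.indicator ?_ measurableSet_Ioc).aestronglyMeasurable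
    fun_prop
  · filter_upwards [eventually_gt_atTop 0] with x hx
    refine (ae_restrict_iff' measurableSet_Ioi).2 (Eventually.of_forall fun u hu => ?_)
    have hu0 : 0 < u := hu
    rw [add_sub_cancel_right]
    by_cases hux : u ∈ Ioc 0 x
    · rw [indicator_of_mem hux]
      have h1 := (div_le_one hx).2 hux.2
      have h2 : 0 ≤ 2 - u / x := by linarith
      have h3 : 2 - u / x ≤ 2 := by linarith [div_pos hu0 hx]
      rw [Real.norm_of_nonneg (by positivity)]
      have h4 : Real.exp (u - 2 * x) ≤ Real.exp (-u) := by
        gcongr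
        linarith [hux.2]
      calc g x u ≤ (Real.exp (-u) + Real.exp (-u)) * (u * 2) ^ γ := by
            simp only [hg]
            gcongr
        _ = _ := by
            rw [Real.mul_rpow hu0.le two_pos.le]
            ring
    · rw [indicator_of_notMem hux, norm_zero]
      positivity
  · exact (Real.GammaIntegral_convergent (by positivity)).const_mul _
  · refine (ae_restrict_iff' measurableSet_Ioi).2 (Eventually.of_forall fun u hu => ?_)
    have hu0 : 0 < u := hu
    have h1 : Tendsto (fun x => g x u) atTop (nhds ((Real.exp (-u) + 0) * (u * (2 - 0)) ^ γ)) := by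
      refine Tendsto.mul (tendsto_const_nhds.add ?_) ?_
      · refine Real.tendsto_exp_atBot.comp ?_
        exact tendsto_atBot_add_const_left _ _
          (tendsto_neg_atTop_atBot.comp (tendsto_id.const_mul_atTop two_pos))
      · refine Tendsto.rpow_const ?_ (Or.inr hγ)
        exact (tendsto_const_nhds.sub (tendsto_const_nhds.div_atTop tendsto_id)).const_mul _
    have h2 : (Real.exp (-u) + 0) * (u * (2 - 0)) ^ γ =
        2 ^ γ * (Real.exp (-u) * u ^ (γ + 1 - 1)) := by
      rw [sub_zero, Real.mul_rpow hu0.le two_pos.le, add_sub_cancel_right]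
      ring
    rw [h2] at h1
    refine h1.congr' ?_
    filter_upwards [eventually_ge_atTop u] with x hx
    rw [indicator_of_mem (show u ∈ Ioc 0 x from ⟨hu0, hx⟩)]

theorem tendsto_besselI_of_half_le {β : ℝ} (hβ : 1 / 2 ≤ β) :
    Tendsto (fun x => x ^ (1 / 2 : ℝ) * Real.exp (-x) * besselI β x) atTop
      (nhds (√(2 * Real.pi))⁻¹) := by
  obtain ⟨γ, hγ, rfl⟩ : ∃ γ, 0 ≤ γ ∧ β = γ + 1 / 2 := ⟨β - 1 / 2, by linarith, by ring⟩
  have hG : 0 < Real.Gamma (γ + 1) := Real.Gamma_pos_of_pos (by positivity)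
  have h := (tendsto_integral_cosh_mul_one_sub_sq_rpow hγ).const_mul
    ((√Real.pi * Real.Gamma (γ + 1) * 2 ^ (γ + 1 / 2))⁻¹)
  have hlim : (√Real.pi * Real.Gamma (γ + 1) * 2 ^ (γ + 1 / 2))⁻¹ *
      (2 ^ γ * Real.Gamma (γ + 1)) = (√(2 * Real.pi))⁻¹ := by
    rw [Real.rpow_add two_pos, ← Real.sqrt_eq_rpow, Real.sqrt_mul two_pos.le]
    field_simp
  rw [hlim] at h
  refine h.congr' ?_
  filter_upwards [eventually_gt_atTop 0] with x hx
  have hp := besselI_poisson hγ hx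
  rw [Real.div_rpow hx.le two_pos.le] at hp
  have hx1 : x ^ (γ + 1) = x ^ (1 / 2 : ℝ) * x ^ (γ + 1 / 2) := by
    rw [← Real.rpow_add hx]; ring_nf
  rw [hx1, inv_mul_eq_iff_eq_mul₀ (by positivity)]
  rw [div_mul_eq_mul_div, eq_div_iff (by positivity)] at hp
  linear_combination -(x ^ (1 / 2 : ℝ) * Real.exp (-x)) * hp

theorem tendsto_besselI (β : ℝ) :
    Tendsto (fun x => x ^ (1 / 2 : ℝ) * Real.exp (-x) * besselI β x) atTop
      (nhds (√(2 * Real.pi))⁻¹) := by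
  obtain ⟨n, hn⟩ := exists_nat_ge (1 / 2 - β)
  have hn' : 1 / 2 ≤ β + n := by linarith
  clear hn
  induction n generalizing β with
  | zero => exact tendsto_besselI_of_half_le (by simpa using hn')
  | succ n ih =>
    push_cast at hn'
    have h1 := ih (β + 1) (by linarith)
    have h2 := ih (β + 1 + 1) (by linarith)
    have h3 : Tendsto (fun x : ℝ => 2 * (β + 1) / x) atTop (nhds 0) :=
      tendsto_const_nhds.div_atTop tendsto_id
    have h4 := h2.add (h3.mul h1)
    rw [zero_mul, add_zero] at h4
    refine h4.congr' ?_
    filter_upwards [eventually_gt_atTop 0] with x hx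
    have := besselI_sub_one (β + 1) hx
    rw [add_sub_cancel_right] at this
    rw [this]
    ring

theorem sub_le_of_hasDerivAt_le_exp {f f' : ℝ → ℝ} {X C L : ℝ}
    (hf : ∀ x, X ≤ x → HasDerivAt f (f' x) x)
    (hC : ∀ x, X ≤ x → f' x ≤ C * Real.exp (-(2 * x)))
    (hL : Tendsto f atTop (nhds L)) {x : ℝ} (hx : X ≤ x) :
    L - f x ≤ C / 2 * Real.exp (-(2 * x)) := by
  have hd (y : ℝ) : HasDerivAt (fun y => C / 2 * Real.exp (-(2 * y)))
      (-(C * Real.exp (-(2 * y)))) y := by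
    have h := ((((hasDerivAt_id y).const_mul 2).neg).exp).const_mul (C / 2)
    convert! h using 1
    simp only [Pi.neg_apply, id]
    ring
  have hanti : AntitoneOn (fun y => f y + C / 2 * Real.exp (-(2 * y))) (Ici X) := by
    refine antitoneOn_of_hasDerivWithinAt_nonpos (convex_Ici X)
      (fun y hy => ((hf y hy).add (hd y)).continuousAt.continuousWithinAt)
      (fun y hy => ((hf y (interior_subset hy)).add (hd y)).hasDerivWithinAt) fun y hy => ?_
    linarith [hC y (interior_subset hy)]
  have hexp : Tendsto (fun y => f y + C / 2 * Real.exp (-(2 * y))) atTop (nhds L) := by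
    have h : Tendsto (fun y : ℝ => Real.exp (-(2 * y))) atTop (nhds 0) :=
      Real.tendsto_exp_atBot.comp
        (tendsto_neg_atTop_atBot.comp (tendsto_id.const_mul_atTop two_pos))
    simpa using hL.add (h.const_mul (C / 2))
  have hle : L ≤ f x + C / 2 * Real.exp (-(2 * x)) := by
    refine le_of_tendsto hexp ?_
    filter_upwards [eventually_ge_atTop x] with y hy
    exact hanti hx (hx.trans hy) hy
  linarith

theorem abs_sub_le_of_abs_hasDerivAt_le_exp {f f' : ℝ → ℝ} {X C L : ℝ}
    (hf : ∀ x, X ≤ x → HasDerivAt f (f' x) x)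
    (hC : ∀ x, X ≤ x → |f' x| ≤ C * Real.exp (-(2 * x)))
    (hL : Tendsto f atTop (nhds L)) {x : ℝ} (hx : X ≤ x) :
    |f x - L| ≤ C / 2 * Real.exp (-(2 * x)) := by
  have h1 := sub_le_of_hasDerivAt_le_exp hf (fun y hy => (abs_le.1 (hC y hy)).2) hL hx
  have h2 := sub_le_of_hasDerivAt_le_exp (C := C) (fun y hy => (hf y hy).neg)
    (fun y hy => by linarith [(abs_le.1 (hC y hy)).1]) hL.neg hx
  simp only [Pi.neg_apply] at h2
  exact abs_le.2 ⟨by linarith, by linarith⟩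

/-- Abel's identity for the pair `I_α`, `I_{-α}`. -/
theorem exists_besselI_wronskian_eq (α : ℝ) :
    ∃ c : ℝ, ∀ x, 0 < x →
      x * (besselI α x * besselI (1 - α) x - besselI (-α) x * besselI (α - 1) x) = c := by
  have hder (x : ℝ) (hx : 0 < x) : HasDerivAt
      (fun x => x * (besselI α x * besselI (1 - α) x - besselI (-α) x * besselI (α - 1) x)) 0 x := by
    have h1 := hasDerivAt_besselI' α hx
    have h2 := hasDerivAt_besselI' (1 - α) hx
    have h3 := hasDerivAt_besselI (-α) hx
    have h4 := hasDerivAt_besselI (α - 1) hx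
    rw [show 1 - α - 1 = -α by ring] at h2
    rw [show -α + 1 = 1 - α by ring] at h3
    rw [sub_add_cancel] at h4
    convert! (hasDerivAt_id x).mul ((h1.mul h2).sub (h3.mul h4)) using 1
    simp only [id, Pi.sub_apply, Pi.mul_apply]
    field_simp
    ring
  exact ⟨_, fun x hx => isOpen_Ioi.is_const_of_deriv_eq_zero (convex_Ioi (0 : ℝ)).isPreconnected
    (fun y hy => (hder y hy).differentiableAt.differentiableWithinAt)
    (fun y hy => (hder y hy).deriv) (mem_Ioi.2 hx) (mem_Ioi.2 one_pos)⟩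

theorem isBigO_besselI_neg_sub_of_pos {α : ℝ} (hα : 0 < α) :
    (fun x => besselI (-α) x - besselI α x) =O[atTop]
      fun x => x ^ (-(1 / 2) : ℝ) * Real.exp (-x) := by
  obtain ⟨c, hc⟩ := exists_besselI_wronskian_eq α
  set L := (√(2 * Real.pi))⁻¹ with hL
  have hL0 : 0 < L := by positivity
  have hpos := tendsto_besselI α
  have hq : Tendsto (fun x => besselI (-α) x / besselI α x) atTop (nhds 1) := by
    have h := (tendsto_besselI (-α)).div hpos hL0.ne'
    rw [div_self hL0.ne'] at h
    refine h.congr' ?_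
    filter_upwards [eventually_gt_atTop 0] with x hx
    simp only [Pi.div_apply]
    have := (Real.rpow_pos_of_pos hx (1 / 2)).ne'
    have := (besselI_pos hα hx).ne'
    field_simp
  obtain ⟨X, hX⟩ := eventually_atTop.1 ((eventually_gt_atTop 0).and
    ((hpos.eventually_const_le (show L / 2 < L by linarith)).and
      (hpos.eventually_le_const (show L < 2 * L by linarith))))
  have hder (x : ℝ) (hx : X ≤ x) : HasDerivAt (fun x => besselI (-α) x / besselI α x)
      (c / (x * besselI α x ^ 2)) x := by
    have hx0 := (hX x hx).1
    have hI := (besselI_pos hα hx0).ne'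
    convert! (hasDerivAt_besselI (-α) hx0).div (hasDerivAt_besselI' α hx0) hI using 1
    rw [← hc x hx0, show -α + 1 = 1 - α by ring]
    field_simp
    ring
  have hbound (x : ℝ) (hx : X ≤ x) :
      |c / (x * besselI α x ^ 2)| ≤ |c| * (4 / L ^ 2) * Real.exp (-(2 * x)) := by
    obtain ⟨hx0, hx1, -⟩ := hX x hx
    have h1 : x * besselI α x ^ 2 =
        (x ^ (1 / 2 : ℝ) * Real.exp (-x) * besselI α x) ^ 2 * Real.exp (2 * x) := by
      rw [mul_pow, mul_pow, ← Real.sqrt_eq_rpow, Real.sq_sqrt hx0.le, ← Real.exp_nat_mul,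
        mul_right_comm, mul_assoc x, ← Real.exp_add]
      simp
    have h2 : (L / 2) ^ 2 * Real.exp (2 * x) ≤ x * besselI α x ^ 2 := by
      rw [h1]; gcongr
    rw [abs_div, abs_of_pos (lt_of_lt_of_le (by positivity) h2), Real.exp_neg]
    calc _ ≤ |c| / ((L / 2) ^ 2 * Real.exp (2 * x)) := by gcongr
      _ = _ := by field_simp; norm_num
  refine Asymptotics.IsBigO.of_bound (|c| * (4 / L ^ 2) / 2 * (2 * L)) ?_
  filter_upwards [eventually_ge_atTop X] with x hx
  obtain ⟨hx0, -, hx1⟩ := hX x hx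
  have hI := besselI_pos hα hx0
  have h1 := abs_sub_le_of_abs_hasDerivAt_le_exp hder hbound hq hx
  have h2 : besselI (-α) x - besselI α x =
      (besselI (-α) x / besselI α x - 1) * besselI α x := by field_simp
  have h3 : besselI α x ≤ 2 * L * (x ^ (-(1 / 2) : ℝ) * Real.exp x) := by
    rw [Real.rpow_neg hx0.le]
    rw [Real.exp_neg] at hx1
    field_simp
    field_simp at hx1
    linarith
  rw [h2, norm_mul, Real.norm_eq_abs, Real.norm_of_nonneg hI.le,
    Real.norm_of_nonneg (by positivity)]
  calc _ ≤ |c| * (4 / L ^ 2) / 2 * Real.exp (-(2 * x)) *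
        (2 * L * (x ^ (-(1 / 2) : ℝ) * Real.exp x)) := by gcongr
    _ = |c| * (4 / L ^ 2) / 2 * (2 * L) *
        (x ^ (-(1 / 2) : ℝ) * (Real.exp (-(2 * x)) * Real.exp x)) := by ring
    _ = _ := by rw [← Real.exp_add]; ring_nf

theorem isBigO_besselK (β : ℝ) :
    besselK β =O[atTop] fun x => x ^ (-(1 / 2) : ℝ) * Real.exp (-x) := by
  have h : (fun x => besselI (-β) x - besselI β x) =O[atTop]
      fun x => x ^ (-(1 / 2) : ℝ) * Real.exp (-x) := by
    rcases lt_trichotomy β 0 with hβ | rfl | hβ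
    · have := isBigO_besselI_neg_sub_of_pos (neg_pos.2 hβ)
      rw [neg_neg] at this
      exact this.neg_left.congr_left fun x => by ring
    · simpa using Asymptotics.isBigO_zero _ _
    · exact isBigO_besselI_neg_sub_of_pos hβ
  exact (h.const_mul_left (Real.pi / 2 / Real.sin (β * Real.pi))).congr_left fun x => by
    rw [besselK]; ring

theorem hasDerivAt_besselK (β : ℝ) {x : ℝ} (hx : 0 < x) :
    HasDerivAt (besselK β) (-besselK (β + 1) x + β / x * besselK β x) x := by
  have h := (((hasDerivAt_besselI' (-β) hx).sub (hasDerivAt_besselI β hx)).const_mul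
    (Real.pi / 2)).div_const (Real.sin (β * Real.pi))
  convert! h using 1
  rw [besselK, besselK, show (β + 1) * Real.pi = β * Real.pi + Real.pi by ring,
    Real.sin_add_pi, div_neg, neg_neg, neg_add']
  ring

theorem exists_abs_besselK_le (β : ℝ) :
    ∃ C, 0 ≤ C ∧ ∀ x, 1 ≤ x →
      |besselK β x| ≤ C * (x ^ (-(1 / 2) : ℝ) * Real.exp (-x)) := by
  obtain ⟨C, hC0, hC⟩ := (isBigO_besselK β).exists_nonneg
  obtain ⟨X, hX⟩ := eventually_atTop.1 hC.bound
  have hcont : ContinuousOn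
      (fun x => besselK β x / (x ^ (-(1 / 2) : ℝ) * Real.exp (-x))) (Icc 1 X) := by
    intro x hx
    have hx0 : 0 < x := one_pos.trans_le hx.1
    refine ContinuousAt.continuousWithinAt ?_
    refine (hasDerivAt_besselK β hx0).continuousAt.div ?_ (by positivity)
    exact (Real.continuousAt_rpow_const _ _ (Or.inl hx0.ne')).mul (by fun_prop)
  obtain ⟨D, hD⟩ := isCompact_Icc.exists_bound_of_continuousOn hcont
  refine ⟨max C D, le_max_of_le_left hC0, fun x hx => ?_⟩
  have hx0 : 0 < x := one_pos.trans_le hx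
  have hE : 0 < x ^ (-(1 / 2) : ℝ) * Real.exp (-x) := by positivity
  rcases le_total X x with h | h
  · have := hX x h
    rw [Real.norm_of_nonneg hE.le, Real.norm_eq_abs] at this
    exact this.trans (by gcongr; exact le_max_left _ _)
  · have := hD x ⟨hx, h⟩
    rw [Real.norm_eq_abs, abs_div, abs_of_pos hE, div_le_iff₀ hE] at this
    exact this.trans (by gcongr; exact le_max_right _ _)

theorem hasDerivAt_rpow_mul_besselK (p β : ℝ) {κ t : ℝ} (hκ : 0 < κ) (ht : 0 < t) :
    HasDerivAt (fun t => t ^ p * besselK β (κ * t))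
      ((p + β) * (t ^ (p - 1) * besselK β (κ * t)) - κ * (t ^ p * besselK (β + 1) (κ * t))) t := by
  have h1 := (hasDerivAt_besselK β (mul_pos hκ ht)).comp t ((hasDerivAt_id t).const_mul κ)
  convert! (Real.hasDerivAt_rpow_const (p := p) (Or.inl ht.ne')).mul h1 using 1
  simp only [Function.comp_apply]
  rw [Real.rpow_sub_one ht.ne']
  field_simp
  ring

theorem exists_abs_rpow_mul_besselK_le (p β : ℝ) :
    ∃ C, 0 ≤ C ∧ ∀ κ r q : ℝ, 1 ≤ κ → 1 ≤ r → q ≤ p →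
      |r ^ q * besselK β (κ * r)| ≤
        C * (κ ^ (-(1 / 2) : ℝ) * r ^ (p - 1 / 2) * Real.exp (-(κ * r))) := by
  obtain ⟨C, hC0, hC⟩ := exists_abs_besselK_le β
  refine ⟨C, hC0, fun κ r q hκ hr hq => ?_⟩
  have hκ0 : 0 < κ := one_pos.trans_le hκ
  have hr0 : 0 < r := one_pos.trans_le hr
  have h1 := hC (κ * r) (by nlinarith)
  have h2 : r ^ q ≤ r ^ p := Real.rpow_le_rpow_of_exponent_le hr hq
  rw [abs_mul, abs_of_pos (Real.rpow_pos_of_pos hr0 q)]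
  calc _ ≤ r ^ p * (C * ((κ * r) ^ (-(1 / 2) : ℝ) * Real.exp (-(κ * r)))) := by gcongr
    _ = _ := by
      rw [Real.mul_rpow hκ0.le hr0.le, sub_eq_add_neg p, Real.rpow_add hr0]
      ring

theorem exists_abs_iterate_deriv_rpow_mul_besselK_le (p β : ℝ) :
    ∃ C, 0 < C ∧ ∀ κ r : ℝ, 1 ≤ κ → 1 ≤ r → ∀ n ≤ 2,
      |deriv^[n] (fun t => t ^ p * besselK β (κ * t)) r| ≤
        C * κ ^ n * (κ ^ (-(1 / 2) : ℝ) * r ^ (p - 1 / 2) * Real.exp (-(κ * r))) := by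
  obtain ⟨C₀, hC₀, h₀⟩ := exists_abs_rpow_mul_besselK_le p β
  obtain ⟨C₁, hC₁, h₁⟩ := exists_abs_rpow_mul_besselK_le p (β + 1)
  obtain ⟨C₂, hC₂, h₂⟩ := exists_abs_rpow_mul_besselK_le p (β + 1 + 1)
  set a := |p + β| with ha
  set b := |p - 1 + β| with hb
  set c := |p + (β + 1)| with hc
  refine ⟨1 + C₀ + (a * C₀ + C₁) + (a * (b * C₀ + C₁) + (c * C₁ + C₂)), by positivity,
    fun κ r hκ hr n hn => ?_⟩
  have hκ0 : 0 < κ := one_pos.trans_le hκ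
  have hr0 : 0 < r := one_pos.trans_le hr
  have hd (q γ t : ℝ) (ht : 0 < t) := hasDerivAt_rpow_mul_besselK q γ hκ0 ht
  specialize h₀ κ r
  specialize h₁ κ r
  specialize h₂ κ r
  set E := κ ^ (-(1 / 2) : ℝ) * r ^ (p - 1 / 2) * Real.exp (-(κ * r)) with hE
  have hE0 : 0 < E := by positivity
  have hder : deriv (fun t => t ^ p * besselK β (κ * t)) =ᶠ[nhds r] fun t =>
      (p + β) * (t ^ (p - 1) * besselK β (κ * t)) - κ * (t ^ p * besselK (β + 1) (κ * t)) := by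
    filter_upwards [lt_mem_nhds hr0] with t ht
    exact (hd p β t ht).deriv
  have hp1 : p - 1 ≤ p := by linarith
  have hp2 : p - 1 - 1 ≤ p := by linarith
  have bound {x y u A B : ℝ} (hx : |x| ≤ A * E) (hA : 0 ≤ A) (hy : |y| ≤ B * E) :
      |u * x - κ * y| ≤ κ * ((|u| * A + B) * E) := by
    calc |u * x - κ * y| ≤ |u| * |x| + κ * |y| := by
          refine (abs_sub _ _).trans ?_
          rw [abs_mul, abs_mul, abs_of_pos hκ0]
      _ ≤ 1 * (|u| * (A * E)) + κ * (B * E) := by rw [one_mul]; gcongr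
      _ ≤ κ * (|u| * (A * E)) + κ * (B * E) := by gcongr
      _ = _ := by ring
  interval_cases n
  · refine (h₀ p hκ hr le_rfl).trans ?_
    rw [pow_zero, mul_one]
    gcongr
    linarith [show 0 ≤ a * C₀ + C₁ by positivity,
      show 0 ≤ a * (b * C₀ + C₁) + (c * C₁ + C₂) by positivity]
  · rw [Function.iterate_one, hder.eq_of_nhds]
    refine (bound (h₀ (p - 1) hκ hr hp1) hC₀ (h₁ p hκ hr le_rfl)).trans ?_
    rw [pow_one, mul_comm _ κ, mul_assoc κ, ← ha]
    refine mul_le_mul_of_nonneg_left (mul_le_mul_of_nonneg_right ?_ hE0.le) hκ0.le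
    linarith [show 0 ≤ a * (b * C₀ + C₁) + (c * C₁ + C₂) by positivity]
  · have hX := (bound (u := p - 1 + β) (h₀ (p - 1 - 1) hκ hr hp2) hC₀
      (h₁ (p - 1) hκ hr hp1)).trans_eq (mul_assoc _ _ _).symm
    have hY := (bound (u := p + (β + 1)) (h₁ (p - 1) hκ hr hp1) hC₁
      (h₂ p hκ hr le_rfl)).trans_eq (mul_assoc _ _ _).symm
    have h := ((hd (p - 1) β r hr0).const_mul (p + β)).fun_sub ((hd p (β + 1) r hr0).const_mul κ)
    rw [Function.iterate_succ_apply, Function.iterate_one, hder.deriv_eq, h.deriv]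
    refine (bound hX (by positivity) hY).trans ?_
    rw [← ha, ← hb, ← hc]
    calc _ = (a * (b * C₀ + C₁) + (c * C₁ + C₂)) * κ ^ 2 * E := by ring
      _ ≤ _ := by
        refine mul_le_mul_of_nonneg_right (mul_le_mul_of_nonneg_right ?_ (by positivity)) hE0.le
        linarith [show 0 ≤ a * C₀ + C₁ by positivity]

/-- derivative bounds for `𝒦_k(r) = r^{ν/2} K_{|1+ν/2|}(|k| r)`. -/
theorem stmt10 (ν : ℝ) (hν : ν < 0) (hα : ¬ ∃ n : ℤ, |1 + ν / 2| = (n : ℝ)) :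
    ∃ C > 0, ∀ k : ℤ, k ≠ 0 → ∀ r : ℝ, 1 ≤ r → ∀ n : ℕ, n ≤ 2 →
      |deriv^[n] (fun t : ℝ => t ^ (ν / 2) * besselK |1 + ν / 2| (|(k : ℝ)| * t)) r|
        ≤ C * |(k : ℝ)| ^ ((n : ℝ) - 1 / 2) * r ^ ((ν - 1) / 2)
            * Real.exp (-(|(k : ℝ)| * r)) := by
  obtain ⟨C, hC0, hC⟩ := exists_abs_iterate_deriv_rpow_mul_besselK_le (ν / 2) |1 + ν / 2|
  refine ⟨C, hC0, fun k hk r hr n hn => ?_⟩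
  have hk1 : 1 ≤ |(k : ℝ)| := mod_cast Int.one_le_abs hk
  refine (hC _ r hk1 hr n hn).trans_eq ?_
  rw [sub_eq_add_neg (n : ℝ), Real.rpow_add (by positivity), Real.rpow_natCast,
    show (ν - 1) / 2 = ν / 2 - 1 / 2 by ring]
  ring
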